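/- arXiv:2501.05535 — 8 statements merged into one kernel-verified Lean document; each statement's English description precedes it below -/
import Mathlib

section
/- Let Y be a countable linearly ordered type and let p and q be probability mass functions on Y. Suppose there is a real number ε ≥ 0 such that for every s ∈ Y, p(s) ≤ e^ε · q(s) and q(s) ≤ e^ε · p(s). Then P(p,q) ≤ e^ε · P(q,p), where P(p,q) denotes the precedence probability of p over q. -/
open scoped ENNReal

/-- The precedence probability of `p` over `q` on a countable linearly ordered type:
the probability that an independent sample from `p` is ordered before an independent
sample from `q`, where equal values are ordered uniformly at random. -/
noncomputable def precProb {Y : Type*} [Countable Y] [LinearOrder Y] (p q : PMF Y) : ℝ≥0∞ :=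
  (∑' s : Y, ∑' s' : Y, if s < s' then p s * q s' else 0) + (1 / 2) * ∑' s : Y, p s * q s

/-- Weight of an ordered pair. -/
noncomputable def precW {Y : Type*} [LinearOrder Y] (s s' : Y) : ℝ≥0∞ :=
  (if s < s' then 1 else 0) + (if s' = s then 1 / 2 else 0)

theorem precW_add {Y : Type*} [LinearOrder Y] (s s' : Y) : precW s s' + precW s' s = 1 := by
  unfold precW
  rcases lt_trichotomy s s' with h | h | h
  · simp [h, h.not_gt, h.ne, h.ne']
  · subst h
    simp [ENNReal.inv_two_add_inv_two]
  · simp [h, h.not_gt, h.ne, h.ne']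

theorem precProb_eq {Y : Type*} [Countable Y] [LinearOrder Y] (p q : PMF Y) :
    precProb p q = ∑' s : Y, ∑' s' : Y, precW s s' * (p s * q s') := by
  unfold precProb
  rw [← ENNReal.tsum_mul_left, ← ENNReal.tsum_add]
  refine tsum_congr fun s => ?_
  have : (1 / 2 : ℝ≥0∞) * (p s * q s) =
      ∑' s' : Y, if s' = s then (1 / 2 : ℝ≥0∞) * (p s * q s') else 0 := by
    rw [tsum_eq_single s]
    · simp
    · intro b hb
      simp [hb]
  rw [this, ← ENNReal.tsum_add]
  refine tsum_congr fun s' => ?_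
  unfold precW
  rw [add_mul]
  congr 1 <;> split_ifs <;> simp

theorem precProb_add {Y : Type*} [Countable Y] [LinearOrder Y] (p q : PMF Y) :
    precProb p q + precProb q p = 1 := by
  rw [precProb_eq p q, precProb_eq q p, ENNReal.tsum_comm (f := fun s s' => precW s s' * (q s * p s')),
    ← ENNReal.tsum_add]
  have : ∀ s, (∑' s', precW s s' * (p s * q s')) + (∑' s', precW s' s * (q s' * p s)) = p s := by
    intro s
    rw [← ENNReal.tsum_add]
    have : ∀ s', precW s s' * (p s * q s') + precW s' s * (q s' * p s) = p s * q s' := by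
      intro s'
      rw [mul_comm (q s'), ← add_mul, precW_add, one_mul]
    simp_rw [this]
    rw [ENNReal.tsum_mul_left, q.tsum_coe, mul_one]
  simp_rw [this]
  exact p.tsum_coe

theorem key_pointwise (t a b c d : ℝ≥0∞) (ht : t ≠ ∞) (ha : a ≠ ∞) (hb : b ≠ ∞) (hc : c ≠ ∞)
    (hd : d ≠ ∞) (h1 : a ≤ t * b) (h2 : d ≤ t * c) :
    t * (b * d) + t * (a * c) ≤ t ^ 2 * (b * c) + a * d := by
  lift t to NNReal using ht
  lift a to NNReal using ha
  lift b to NNReal using hb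
  lift c to NNReal using hc
  lift d to NNReal using hd
  norm_cast at *
  rw [← NNReal.coe_le_coe] at *
  push_cast at *
  nlinarith [mul_nonneg (sub_nonneg.2 h1) (sub_nonneg.2 h2)]

theorem key_sum {Y : Type*} [Countable Y] [LinearOrder Y] (p q : PMF Y) (t : ℝ≥0∞) (ht : t ≠ ∞)
    (h : ∀ s : Y, p s ≤ t * q s ∧ q s ≤ t * p s) :
    t * precProb q q + t * precProb p p ≤ t ^ 2 * precProb q p + precProb p q := by
  simp only [precProb_eq, ← ENNReal.tsum_mul_left, ← ENNReal.tsum_add]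
  refine ENNReal.tsum_le_tsum fun s => ENNReal.tsum_le_tsum fun s' => ?_
  have := key_pointwise t (p s) (q s) (p s') (q s') ht (p.apply_ne_top _) (q.apply_ne_top _)
    (p.apply_ne_top _) (q.apply_ne_top _) (h s).1 (h s').2
  calc _ = precW s s' * (t * (q s * q s') + t * (p s * p s')) := by ring
    _ ≤ precW s s' * (t ^ 2 * (q s * p s') + p s * q s') := by gcongr
    _ = _ := by ring

theorem precProb_le_of_two_sided_DP_bound {Y : Type*} [Countable Y] [LinearOrder Y]
    (p q : PMF Y) (ε : ℝ) (hε : 0 ≤ ε)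
    (h : ∀ s : Y, p s ≤ ENNReal.ofReal (Real.exp ε) * q s ∧
      q s ≤ ENNReal.ofReal (Real.exp ε) * p s) :
    precProb p q ≤ ENNReal.ofReal (Real.exp ε) * precProb q p := by
  rcases hε.eq_or_lt with rfl | hpos
  · have : p = q := by
      ext s
      have := h s
      simp only [Real.exp_zero, ENNReal.ofReal_one, one_mul] at this
      exact le_antisymm this.1 this.2
    subst this
    simp
  have ht1 : 1 < Real.exp ε := Real.one_lt_exp_iff.2 hpos
  have ht1' : 1 < ENNReal.ofReal (Real.exp ε) := by simpa using hpos
  have ht : ENNReal.ofReal (Real.exp ε) ≠ ∞ := ENNReal.ofReal_ne_top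
  have hk := key_sum p q _ ht h
  have hpq := precProb_add p q
  have hpp := precProb_add p p
  have hqq := precProb_add q q
  have fin : ∀ a b : PMF Y, precProb a b ≠ ∞ := fun a b hh => by
    have := precProb_add a b
    simp [hh] at this
  generalize ENNReal.ofReal (Real.exp ε) = t at *
  have f1 := fin p q
  have f2 := fin q p
  have f3 := fin p p
  have f4 := fin q q
  generalize precProb p q = x at *
  generalize precProb q p = y at *
  generalize precProb p p = u at *
  generalize precProb q q = v at *
  clear fin h
  lift t to NNReal using ht
  lift x to NNReal using f1
  lift y to NNReal using f2
  lift u to NNReal using f3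
  lift v to NNReal using f4
  norm_cast at *
  rw [← NNReal.coe_le_coe] at *
  rw [← NNReal.coe_lt_coe] at ht1'
  rw [← NNReal.coe_inj] at hpq hpp hqq
  push_cast at *
  have hu : (u : ℝ) = 1 / 2 := by linarith
  have hv : (v : ℝ) = 1 / 2 := by linarith
  have hx : (x : ℝ) = 1 - y := by linarith
  rw [hu, hv, hx] at hk
  rw [hx]
  have : 0 ≤ ((t : ℝ) - 1) * ((t + 1) * y - 1) := by nlinarith
  have := nonneg_of_mul_nonneg_right this (by linarith)
  linarith
end

section
/- Let f, g : ℝ → [0,∞) be measurable functions with ∫ f = ∫ g = 1 (with respect to Lebesgue measure), and let μ and ν be the measures on ℝ with densities f and g respectively. Suppose there is a real number ε ≥ 0 such that for almost every x ∈ ℝ, f(x) ≤ e^ε · g(x) and g(x) ≤ e^ε · f(x). Then (μ.prod ν){(x,y) : x < y} ≤ e^ε · (μ.prod ν){(x,y) : y < x}. -/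
open MeasureTheory
open scoped ENNReal

theorem coe_tri (ρ σ : Measure ℝ) [IsFiniteMeasure ρ] [IsFiniteMeasure σ]
    (hσ : ∀ x, σ {x} = 0) :
    (ρ.prod σ).real {p : ℝ × ℝ | p.1 < p.2} + (ρ.prod σ).real {p : ℝ × ℝ | p.2 < p.1}
      = ρ.real Set.univ * σ.real Set.univ := by
  have hL : MeasurableSet {p : ℝ × ℝ | p.1 < p.2} := measurableSet_lt measurable_fst measurable_snd
  have hG : MeasurableSet {p : ℝ × ℝ | p.2 < p.1} := measurableSet_lt measurable_snd measurable_fst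
  have hD : MeasurableSet {p : ℝ × ℝ | p.1 = p.2} :=
    measurableSet_eq_fun measurable_fst measurable_snd
  have hD0 : (ρ.prod σ) {p : ℝ × ℝ | p.1 = p.2} = 0 := by
    rw [Measure.prod_apply hD]
    have : ∀ x : ℝ, Prod.mk x ⁻¹' {p : ℝ × ℝ | p.1 = p.2} = {x} := by
      intro x; ext y; simp [eq_comm]
    simp [this, hσ]
  have e : (ρ.prod σ).real ({p : ℝ × ℝ | p.1 < p.2} ∪ {p : ℝ × ℝ | p.2 < p.1})
      = (ρ.prod σ).real Set.univ := by
    apply measureReal_congr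
    rw [ae_eq_univ]
    convert hD0 using 2
    ext p
    simp only [Set.mem_compl_iff, Set.mem_union, Set.mem_ofPred_eq, not_or, not_lt]
    exact ⟨fun h => le_antisymm h.2 h.1, fun h => ⟨h.ge, h.le⟩⟩
  rw [measureReal_union _ hG] at e
  · rw [e, ← Set.univ_prod_univ, measureReal_prod_prod]
  · rw [Set.disjoint_left]
    intro p h1 h2
    have h1' : p.1 < p.2 := h1
    have h2' : p.2 < p.1 := h2
    exact lt_asymm h1' h2'

theorem coe_swap (ρ : Measure ℝ) [IsFiniteMeasure ρ] :
    (ρ.prod ρ).real {p : ℝ × ℝ | p.1 < p.2} = (ρ.prod ρ).real {p : ℝ × ℝ | p.2 < p.1} := by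
  have hL : MeasurableSet {p : ℝ × ℝ | p.1 < p.2} := measurableSet_lt measurable_fst measurable_snd
  conv_lhs => rw [← Measure.prod_swap]
  rw [map_measureReal_apply measurable_swap hL]
  rfl

theorem coe_cmp (ρ σ τ : Measure ℝ) [IsFiniteMeasure ρ] [IsFiniteMeasure σ] [IsFiniteMeasure τ]
    (a : ℝ) (ha : 0 ≤ a) (h : σ ≤ ENNReal.ofReal a • τ) (S : Set (ℝ × ℝ)) :
    (ρ.prod σ).real S ≤ a * (ρ.prod τ).real S := by
  have h1 : ρ.prod σ ≤ ENNReal.ofReal a • ρ.prod τ := by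
    rw [← Measure.prod_smul_right]
    exact Measure.prod_mono le_rfl h
  have h2 := h1 S
  rw [Measure.smul_apply, smul_eq_mul] at h2
  have h3 := ENNReal.toReal_mono (by finiteness) h2
  rwa [ENNReal.toReal_mul, ENNReal.toReal_ofReal ha] at h3

theorem coe_quantile (μ : Measure ℝ) [IsProbabilityMeasure μ] (hμ : ∀ x, μ {x} = 0)
    (t : ℝ) (h0 : 0 < t) (h1 : t < 1) : ∃ m, μ.real (Set.Iic m) = t := by
  have hc : Continuous (ProbabilityTheory.cdf μ) := by
    rw [continuous_iff_continuousAt]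
    intro x
    rw [(ProbabilityTheory.monotone_cdf μ).continuousAt_iff_leftLim_eq_rightLim,
      StieltjesFunction.rightLim_eq]
    have := hμ x
    rw [← ProbabilityTheory.measure_cdf μ, StieltjesFunction.measure_singleton,
      ENNReal.ofReal_eq_zero] at this
    exact le_antisymm ((ProbabilityTheory.monotone_cdf μ).leftLim_le le_rfl) (by linarith)
  obtain ⟨m, hm⟩ := mem_range_of_exists_le_of_exists_ge hc
    ((ProbabilityTheory.tendsto_cdf_atBot μ).eventually (eventually_le_nhds h0)).exists
    ((ProbabilityTheory.tendsto_cdf_atTop μ).eventually (eventually_ge_nhds h1)).exists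
  exact ⟨m, by rw [← ProbabilityTheory.cdf_eq_real, hm]⟩

theorem coe_main (μ ν : Measure ℝ) [IsProbabilityMeasure μ] [IsProbabilityMeasure ν]
    (hμ0 : ∀ x, μ {x} = 0) (hν0 : ∀ x, ν {x} = 0) (a : ℝ) (ha : 0 < a)
    (hμ : μ ≤ ENNReal.ofReal a • ν) (hν : ν ≤ ENNReal.ofReal a • μ) :
    (μ.prod ν).real {p : ℝ × ℝ | p.1 < p.2} ≤ a * (μ.prod ν).real {p : ℝ × ℝ | p.2 < p.1} := by
  obtain ⟨m, hm⟩ := coe_quantile μ hμ0 (a / (a + 1)) (by positivity)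
    (by rw [div_lt_one (by positivity)]; linarith)
  set L := {p : ℝ × ℝ | p.1 < p.2} with hL'
  set G := {p : ℝ × ℝ | p.2 < p.1} with hG'
  have hL : MeasurableSet L := measurableSet_lt measurable_fst measurable_snd
  set A := Set.Iic m
  set B := Set.Ioi m
  have hB : μ.real B = 1 - a / (a + 1) := by
    rw [← hm, ← probReal_compl_eq_one_sub measurableSet_Iic, Set.compl_Iic]
  have hνB : ν.real B = 1 - ν.real A := by
    rw [← probReal_compl_eq_one_sub measurableSet_Iic, Set.compl_Iic]
  have cover : (μ.prod ν).real L ≤ μ.real A * ν.real B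
      + ((μ.restrict A).prod (ν.restrict A)).real L
      + ((μ.restrict B).prod (ν.restrict B)).real L := by
    rw [Measure.prod_restrict, Measure.prod_restrict, measureReal_restrict_apply hL,
      measureReal_restrict_apply hL, ← measureReal_prod_prod]
    refine le_trans (measureReal_mono (?_ : L ⊆ (A ×ˢ B ∪ L ∩ A ×ˢ A) ∪ L ∩ B ×ˢ B))
      ((measureReal_union_le _ _).trans (by gcongr; exact measureReal_union_le _ _))
    rintro ⟨x, y⟩ hxy
    have hxy' : x < y := hxy
    simp only [Set.mem_union, Set.mem_inter_iff, Set.mem_prod, A, B, Set.mem_Iic, Set.mem_Ioi, hxy,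
      true_and]
    rcases le_or_gt x m with h1 | h1 <;> rcases le_or_gt y m with h2 | h2
    · simp [h1, h2]
    · simp [h1, h2]
    · linarith
    · simp [h1, h2]
  have z : ∀ (τ : Measure ℝ) (S : Set ℝ), (∀ x, τ {x} = 0) → ∀ x, (τ.restrict S) {x} = 0 :=
    fun τ S h x => le_antisymm ((Measure.restrict_apply_le S {x}).trans (h x).le) zero_le
  have r : ∀ (σ τ : Measure ℝ) (S : Set ℝ), σ ≤ ENNReal.ofReal a • τ →
      σ.restrict S ≤ ENNReal.ofReal a • τ.restrict S := by
    intro σ τ S h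
    rw [← Measure.restrict_smul]
    exact Measure.restrict_mono le_rfl h
  have bAA := coe_tri (μ.restrict A) (ν.restrict A) (z _ _ hν0)
  have mAA := coe_tri (μ.restrict A) (μ.restrict A) (z _ _ hμ0)
  have mBB := coe_tri (μ.restrict B) (μ.restrict B) (z _ _ hμ0)
  have tot := coe_tri μ ν hν0
  have sA := coe_swap (μ.restrict A)
  have sB := coe_swap (μ.restrict B)
  have cB := coe_cmp (μ.restrict B) (ν.restrict B) (μ.restrict B) a ha.le (r _ _ _ hν) L
  have cA := coe_cmp (μ.restrict A) (μ.restrict A) (ν.restrict A) a ha.le (r _ _ _ hμ) G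
  simp only [measureReal_restrict_apply_univ, probReal_univ, ← hL', ← hG'] at *
  rw [hm] at *
  rw [hB] at *
  rw [hνB] at *
  set t := a / (a + 1) with ht
  have hta : t * (a + 1) = a := by rw [ht]; field_simp
  have hLB : a * ((μ.restrict B).prod (μ.restrict B)).real L = a * (1 - t) ^ 2 / 2 := by
    have : ((μ.restrict B).prod (μ.restrict B)).real L = (1 - t) ^ 2 / 2 := by linarith
    rw [this]; ring
  have hGA : ((μ.restrict A).prod (μ.restrict A)).real G = t ^ 2 / 2 := by linarith
  have hGA' : a * (1 - t) ^ 2 / 2 ≤ ((μ.restrict A).prod (ν.restrict A)).real G := by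
    rw [hGA] at cA
    have e : t ^ 2 / 2 = a * (a * (1 - t) ^ 2 / 2) := by
      have : t = a * (1 - t) := by linarith
      have h2 : t ^ 2 = (a * (1 - t)) ^ 2 := by rw [← this]
      rw [h2]; ring
    rw [e] at cA
    exact le_of_mul_le_mul_left cA ha
  have fin : (μ.prod ν).real L ≤ t := by nlinarith
  have : (μ.prod ν).real L * (a + 1) ≤ a := by
    have := mul_le_mul_of_nonneg_right fin (by linarith : 0 ≤ a + 1)
    linarith
  have e : (μ.prod ν).real G = 1 - (μ.prod ν).real L := by linarith
  rw [e]; linarith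

theorem continuous_ordering_equality (f g : ℝ → ℝ) (hf : Measurable f) (hg : Measurable g)
    (hf0 : ∀ x, 0 ≤ f x) (hg0 : ∀ x, 0 ≤ g x)
    (hfint : ∫ x : ℝ, f x ∂volume = 1) (hgint : ∫ x : ℝ, g x ∂volume = 1)
    (ε : ℝ) (hε : 0 ≤ ε)
    (h : ∀ᵐ x ∂(volume : Measure ℝ),
      f x ≤ Real.exp ε * g x ∧ g x ≤ Real.exp ε * f x) :
    ((volume.withDensity fun x => ENNReal.ofReal (f x)).prod
        (volume.withDensity fun x => ENNReal.ofReal (g x))) {p : ℝ × ℝ | p.1 < p.2} ≤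
      ENNReal.ofReal (Real.exp ε) *
        ((volume.withDensity fun x => ENNReal.ofReal (f x)).prod
          (volume.withDensity fun x => ENNReal.ofReal (g x))) {p : ℝ × ℝ | p.2 < p.1} := by
  have prob : ∀ k : ℝ → ℝ, (∀ x, 0 ≤ k x) → ∫ x : ℝ, k x ∂volume = 1 →
      IsProbabilityMeasure (volume.withDensity fun x => ENNReal.ofReal (k x)) := by
    intro k k0 hk
    refine ⟨?_⟩
    have hi : Integrable k := by
      by_contra hn
      rw [integral_undef hn] at hk
      exact zero_ne_one hk
    rw [withDensity_apply _ MeasurableSet.univ, Measure.restrict_univ,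
      ← ofReal_integral_eq_lintegral_ofReal hi (Filter.Eventually.of_forall k0), hk,
      ENNReal.ofReal_one]
  have hpos := Real.exp_pos ε
  have cmp : ∀ k l : ℝ → ℝ, Measurable l →
      (∀ᵐ x ∂(volume : Measure ℝ), k x ≤ Real.exp ε * l x) →
      (volume.withDensity fun x => ENNReal.ofReal (k x)) ≤
        ENNReal.ofReal (Real.exp ε) • volume.withDensity fun x => ENNReal.ofReal (l x) := by
    intro k l hl hkl
    rw [← withDensity_smul _ hl.ennreal_ofReal]
    apply withDensity_mono
    filter_upwards [hkl] with x hx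
    rw [Pi.smul_apply, smul_eq_mul, ← ENNReal.ofReal_mul hpos.le]
    exact ENNReal.ofReal_le_ofReal hx
  have := prob f hf0 hfint
  have := prob g hg0 hgint
  have key := coe_main _ _ (fun x => measure_singleton x) (fun x => measure_singleton x)
    (Real.exp ε) hpos (cmp f g hg (h.mono fun x hx => hx.1)) (cmp g f hf (h.mono fun x hx => hx.2))
  have k2 := ENNReal.ofReal_le_ofReal key
  rwa [ENNReal.ofReal_mul hpos.le, ofReal_measureReal, ofReal_measureReal] at k2
end

section
/- Let Y be a countable linearly ordered type, let p and q be probability mass functions on Y, and let ε ≥ 0 and k ≥ 0 be real numbers. Suppose that for every s ∈ Y, p(s) ≤ e^{kε} · q(s) and q(s) ≤ e^{kε} · p(s). Then P(p,q) ≤ e^{kε} · P(q,p), where P(p,q) denotes the precedence probability of p over q. -/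
open scoped ENNReal

/-- Mid-distribution function. -/
noncomputable def midCdf {Y : Type*} [LinearOrder Y] (f : Y → ℝ≥0∞) (s : Y) : ℝ≥0∞ :=
  (∑' t : Y, if t < s then f t else 0) + (1 / 2) * f s

lemma sum_midCdf {Y : Type*} [LinearOrder Y] (f g : Y → ℝ≥0∞) :
    (∑' s : Y, ∑' t : Y, if s < t then f s * g t else 0) + (1 / 2) * ∑' s : Y, f s * g s
      = ∑' t, g t * midCdf f t := by
  rw [ENNReal.tsum_comm, ← ENNReal.tsum_mul_left, ← ENNReal.tsum_add]
  refine tsum_congr fun t => ?_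
  rw [midCdf, mul_add, ← ENNReal.tsum_mul_left]
  congr 1
  · refine tsum_congr fun s => ?_
    split_ifs
    · exact mul_comm _ _
    · simp
  · ring

lemma sum_midCdf_add {Y : Type*} [LinearOrder Y] (f g : Y → ℝ≥0∞) :
    (∑' t, g t * midCdf f t) + (∑' t, f t * midCdf g t) = (∑' t, f t) * ∑' t, g t := by
  have key : ∀ x, (∑' t : Y, if t < x then f t else 0) + (∑' t : Y, if x < t then f t else 0)
      + f x = ∑' t, f t := by
    intro x
    have hx : f x = ∑' t, if t = x then f t else 0 := by
      rw [tsum_eq_single x]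
      · simp
      · intro b hb
        simp [hb]
    rw [hx, ← ENNReal.tsum_add, ← ENNReal.tsum_add]
    refine tsum_congr fun t => ?_
    rcases lt_trichotomy t x with h | h | h
    · simp [h, h.ne, h.not_gt]
    · simp [h]
    · simp [h, h.ne', h.not_gt]
  rw [← sum_midCdf g f, ← ENNReal.tsum_mul_left (a := 1 / 2),
    ← ENNReal.tsum_add, ← ENNReal.tsum_add, mul_comm, ← ENNReal.tsum_mul_right]
  refine tsum_congr fun x => ?_
  have h1 : (∑' t : Y, if x < t then g x * f t else 0)
      = g x * ∑' t : Y, if x < t then f t else 0 := by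
    rw [← ENNReal.tsum_mul_left]
    refine tsum_congr fun t => ?_
    split_ifs <;> simp
  have h2 : f x = 1 / 2 * f x + 1 / 2 * f x := by
    rw [← add_mul, ENNReal.add_halves, one_mul]
  rw [← key x, h1, midCdf]
  conv_rhs => rw [h2]
  ring

lemma sum_midCdf_self {Y : Type*} [LinearOrder Y] (f : Y → ℝ≥0∞) (hf : ∑' t, f t ≠ ∞) :
    (∑' t, f t * midCdf f t).toReal = (∑' t, f t).toReal ^ 2 / 2 := by
  have h := sum_midCdf_add f f
  have hfin : ∑' t, f t * midCdf f t ≠ ∞ := by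
    intro h'
    rw [h', top_add] at h
    exact ENNReal.mul_ne_top hf hf h.symm
  have := congrArg ENNReal.toReal h
  rw [ENNReal.toReal_add hfin hfin, ENNReal.toReal_mul] at this
  nlinarith

lemma midCdf_mono {Y : Type*} [LinearOrder Y] (f : Y → ℝ≥0∞) : Monotone (midCdf f) := by
  intro s t hst
  rcases hst.eq_or_lt with rfl | hst
  · exact le_rfl
  have hs : f s = ∑' r, if r = s then f r else 0 := by
    rw [tsum_eq_single s]
    · simp
    · intro b hb
      simp [hb]
  have hh : (1 / 2 : ℝ≥0∞) * f s ≤ f s := by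
    calc (1 / 2 : ℝ≥0∞) * f s ≤ 1 * f s := by
          gcongr
          simp
      _ = f s := one_mul _
  calc midCdf f s ≤ (∑' r : Y, if r < s then f r else 0) + f s := by
        unfold midCdf
        gcongr
    _ ≤ ∑' r : Y, if r < t then f r else 0 := by
        conv_lhs => rw [hs]
        rw [← ENNReal.tsum_add]
        refine ENNReal.tsum_le_tsum fun r => ?_
        rcases lt_trichotomy r s with h | h | h
        · simp [h, h.ne, h.trans hst]
        · simp [h, hst]
        · simp [h.ne', h.not_gt]
    _ ≤ midCdf f t := le_self_add

lemma midCdf_le {Y : Type*} [LinearOrder Y] (f : Y → ℝ≥0∞) (s : Y) :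
    midCdf f s ≤ 2 * ∑' t, f t := by
  rw [midCdf, two_mul]
  gcongr
  · split_ifs <;> simp
  · calc (1 / 2 : ℝ≥0∞) * f s ≤ 1 * f s := by
          gcongr
          simp
      _ = f s := one_mul _
      _ ≤ _ := ENNReal.le_tsum s

lemma hasSum_toReal_of {Y : Type*} {f : Y → ℝ≥0∞} (hf : ∑' t, f t ≠ ∞) :
    HasSum (fun t => (f t).toReal) (∑' t, f t).toReal := by
  rw [ENNReal.tsum_toReal_eq (ENNReal.ne_top_of_tsum_ne_top hf)]
  exact ENNReal.hasSum_toReal hf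

theorem precProb_le_of_two_sided_group_privacy_bound {Y : Type*} [Countable Y] [LinearOrder Y]
    (p q : PMF Y) (ε k : ℝ) (hε : 0 ≤ ε) (hk : 0 ≤ k)
    (h : ∀ s : Y, p s ≤ ENNReal.ofReal (Real.exp (k * ε)) * q s ∧
      q s ≤ ENNReal.ofReal (Real.exp (k * ε)) * p s) :
    precProb p q ≤ ENNReal.ofReal (Real.exp (k * ε)) * precProb q p := by
  have hc1 : 1 ≤ Real.exp (k * ε) := Real.one_le_exp (mul_nonneg hk hε)
  generalize Real.exp (k * ε) = c at h hc1
  have hc0 : 0 < c := by linarith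
  have hA : precProb p q = ∑' t, q t * midCdf p t := sum_midCdf p q
  have hB : precProb q p = ∑' t, p t * midCdf q t := sum_midCdf q p
  have hAB : precProb p q + precProb q p = 1 := by
    rw [hA, hB, sum_midCdf_add, p.tsum_coe, q.tsum_coe, one_mul]
  have hAf : precProb p q ≠ ∞ := fun h' => by simp [h'] at hAB
  have hBf : precProb q p ≠ ∞ := fun h' => by simp [h'] at hAB
  have hABr : (precProb p q).toReal + (precProb q p).toReal = 1 := by
    rw [← ENNReal.toReal_add hAf hBf, hAB, ENNReal.toReal_one]
  suffices hX : 1 / (c + 1) ≤ (precProb q p).toReal by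
    rw [← ENNReal.toReal_le_toReal hAf (ENNReal.mul_ne_top ENNReal.ofReal_ne_top hBf),
      ENNReal.toReal_mul, ENNReal.toReal_ofReal hc0.le]
    rw [div_le_iff₀ (by linarith)] at hX
    nlinarith
  -- real versions
  have hmf : ∀ t, midCdf q t ≠ ∞ := fun t =>
    ne_top_of_le_ne_top (by rw [q.tsum_coe]; simp) (midCdf_le q t)
  set a : ℝ := 1 / (c + 1) with ha
  set D : Set Y := {t | (midCdf q t).toReal < a} with hD
  have hDlow : ∀ s t, s ≤ t → t ∈ D → s ∈ D := fun s t hst ht =>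
    lt_of_le_of_lt (ENNReal.toReal_mono (hmf t) (midCdf_mono q hst)) ht
  set f : Y → ℝ≥0∞ := D.indicator q with hf
  have hfq : ∑' t, f t ≠ ∞ := by
    refine ne_top_of_le_ne_top (b := 1) (by simp) ?_
    rw [← q.tsum_coe]
    exact ENNReal.tsum_le_tsum fun t => Set.indicator_le_self' (fun _ _ => zero_le) t
  have hfm : ∀ t, f t * midCdf f t = f t * midCdf q t := by
    intro t
    by_cases ht : t ∈ D
    · congr 1
      unfold midCdf
      congr 1
      · refine tsum_congr fun s => ?_
        split_ifs with hs
        · simp [hf, hDlow s t hs.le ht]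
        · rfl
      · simp [hf, ht]
    · simp [hf, ht]
  have hfself := sum_midCdf_self f hfq
  have hqself := sum_midCdf_self q (by simp [q.tsum_coe])
  have hle : ∀ g : Y → ℝ≥0∞, ∑' t, g t ≠ ∞ → ∑' t, g t * midCdf q t ≠ ∞ := by
    intro g hg
    refine ne_top_of_le_ne_top (b := (∑' t, g t) * 2) (ENNReal.mul_ne_top hg (by simp)) ?_
    rw [← ENNReal.tsum_mul_right]
    refine ENNReal.tsum_le_tsum fun t => ?_
    have := midCdf_le q t
    rw [q.tsum_coe, mul_one] at this
    gcongr
  have Sp := hasSum_toReal_of (f := p) (by simp [p.tsum_coe])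
  have Sq := hasSum_toReal_of (f := q) (by simp [q.tsum_coe])
  have Sf := hasSum_toReal_of hfq
  have Spm := hasSum_toReal_of (hle p (by simp [p.tsum_coe]))
  have Sqm := hasSum_toReal_of (hle q (by simp [q.tsum_coe]))
  have Sfm := hasSum_toReal_of (hle f hfq)
  rw [← hB] at Spm
  rw [hqself, q.tsum_coe] at Sqm
  simp_rw [hfm] at hfself
  rw [hfself] at Sfm
  rw [p.tsum_coe] at Sp
  rw [q.tsum_coe] at Sq
  have main := hasSum_le (fun t => ?_)
    ((Sp.mul_left a).add ((Sqm.mul_left (1 / c)).add (Sfm.mul_left (c - 1 / c))))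
    (Spm.add ((Sq.mul_left (a / c)).add (Sf.mul_left ((c - 1 / c) * a))))
  · simp only [ENNReal.toReal_one] at main
    generalize (∑' t, f t).toReal = u at main
    have hcc : 0 ≤ c - 1 / c := by
      rw [sub_nonneg, div_le_iff₀ hc0]
      nlinarith
    have h1 : 0 ≤ (c - 1 / c) * (a - u) ^ 2 := mul_nonneg hcc (sq_nonneg _)
    have h2 : a + 1 / (2 * c) - a / c - (c - 1 / c) * a ^ 2 / 2 = a := by
      rw [ha]
      field_simp
      ring
    have h3 : 1 / c * (1 ^ 2 / 2) = 1 / (2 * c) := by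
      field_simp
    nlinarith
  · simp only [ENNReal.toReal_mul]
    have hp1 : (p t).toReal ≤ c * (q t).toReal := by
      have := ENNReal.toReal_mono (ENNReal.mul_ne_top ENNReal.ofReal_ne_top (q.apply_ne_top t))
        (h t).1
      rwa [ENNReal.toReal_mul, ENNReal.toReal_ofReal hc0.le] at this
    have hp2 : 1 / c * (q t).toReal ≤ (p t).toReal := by
      have := ENNReal.toReal_mono (ENNReal.mul_ne_top ENNReal.ofReal_ne_top (p.apply_ne_top t))
        (h t).2
      rw [ENNReal.toReal_mul, ENNReal.toReal_ofReal hc0.le] at this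
      rw [one_div, inv_mul_le_iff₀ hc0]
      exact this
    rw [div_eq_mul_one_div a c]
    generalize 1 / c = d at *
    by_cases ht : t ∈ D
    · have hft : f t = q t := by simp [hf, ht]
      have ht' : (midCdf q t).toReal < a := ht
      rw [hft]
      nlinarith [mul_nonneg (sub_nonneg.2 hp1) (sub_nonneg.2 ht'.le)]
    · have hft : f t = 0 := by simp [hf, ht]
      have ht' : a ≤ (midCdf q t).toReal := not_lt.1 ht
      rw [hft]
      simp only [ENNReal.toReal_zero]
      nlinarith [mul_nonneg (sub_nonneg.2 hp2) (sub_nonneg.2 ht')]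
end

section
/- Let f, g : ℝ → [0,∞) be measurable functions with ∫ f = ∫ g = 1 (with respect to Lebesgue measure), let μ and ν be the measures on ℝ with densities f and g respectively, and let ε ≥ 0 and k ≥ 0 be real numbers. Suppose that for almost every x ∈ ℝ, f(x) ≤ e^{kε} · g(x) and g(x) ≤ e^{kε} · f(x). Then (μ.prod ν){(x,y) : x < y} ≤ e^{kε} · (μ.prod ν){(x,y) : y < x}. -/
open MeasureTheory
open scoped ENNReal

theorem aux_meas_lt : MeasurableSet {p : ℝ × ℝ | p.1 < p.2} :=
  measurableSet_lt measurable_fst measurable_snd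

theorem aux_meas_gt : MeasurableSet {p : ℝ × ℝ | p.2 < p.1} :=
  measurableSet_lt measurable_snd measurable_fst

theorem aux_diag : ∀ᵐ z : ℝ × ℝ ∂((volume : Measure ℝ).prod volume), z.1 ≠ z.2 := by
  have hm : MeasurableSet {z : ℝ × ℝ | z.1 = z.2} :=
    measurableSet_eq_fun measurable_fst measurable_snd
  have : ((volume : Measure ℝ).prod volume) {z : ℝ × ℝ | z.1 = z.2} = 0 := by
    rw [Measure.measure_prod_null hm]
    filter_upwards with x
    have : (Prod.mk x ⁻¹' {z : ℝ × ℝ | z.1 = z.2}) = {x} := by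
      ext y; simp [eq_comm]
    rw [this]; simp
  rw [ae_iff]; simpa using this

theorem aux_sum (u v : ℝ → ℝ) (hu : Integrable u) (hv : Integrable v) :
    (∫ z in {p : ℝ × ℝ | p.1 < p.2}, u z.1 * v z.2 ∂((volume : Measure ℝ).prod volume)) +
    (∫ z in {p : ℝ × ℝ | p.2 < p.1}, u z.1 * v z.2 ∂((volume : Measure ℝ).prod volume))
      = (∫ x, u x) * ∫ x, v x := by
  have hi := hu.mul_prod hv
  rw [← integral_prod_mul, ← setIntegral_union _ aux_meas_gt hi.integrableOn hi.integrableOn]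
  · rw [← setIntegral_univ (μ := (volume : Measure ℝ).prod volume)]
    apply setIntegral_congr_set
    filter_upwards [aux_diag] with z hz
    apply propext
    exact ⟨fun _ => trivial, fun _ => lt_or_gt_of_ne hz⟩
  · rw [Set.disjoint_left]
    intro z hz hz2
    simp only [Set.mem_ofPred_eq] at hz hz2
    exact lt_asymm hz hz2

theorem aux_swap (u v : ℝ → ℝ) :
    (∫ z in {p : ℝ × ℝ | p.1 < p.2}, u z.1 * v z.2 ∂((volume : Measure ℝ).prod volume)) =
    (∫ z in {p : ℝ × ℝ | p.2 < p.1}, v z.1 * u z.2 ∂((volume : Measure ℝ).prod volume)) := by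
  rw [← integral_indicator aux_meas_lt, ← integral_indicator aux_meas_gt, ← integral_prod_swap]
  congr 1
  ext z
  simp only [Set.indicator, Set.mem_ofPred_eq, Prod.fst_swap, Prod.snd_swap, mul_comm]

theorem aux_measure (f g : ℝ → ℝ) (hf : Measurable f) (hg : Measurable g)
    (hf0 : ∀ x, 0 ≤ f x) (hg0 : ∀ x, 0 ≤ g x) (hfi : Integrable f) (hgi : Integrable g)
    (s : Set (ℝ × ℝ)) (hs : MeasurableSet s) :
    ((volume.withDensity fun x => ENNReal.ofReal (f x)).prod
        (volume.withDensity fun x => ENNReal.ofReal (g x))) s =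
    ENNReal.ofReal (∫ z in s, f z.1 * g z.2 ∂((volume : Measure ℝ).prod volume)) := by
  rw [prod_withDensity hf.ennreal_ofReal hg.ennreal_ofReal, withDensity_apply _ hs,
    ofReal_integral_eq_lintegral_ofReal (hfi.mul_prod hgi).integrableOn]
  · simp_rw [ENNReal.ofReal_mul (hf0 _)]
  · filter_upwards with z
    exact mul_nonneg (hf0 _) (hg0 _)

theorem continuous_group_ordering_equality (f g : ℝ → ℝ) (hf : Measurable f) (hg : Measurable g)
    (hf0 : ∀ x, 0 ≤ f x) (hg0 : ∀ x, 0 ≤ g x)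
    (hfint : ∫ x : ℝ, f x ∂volume = 1) (hgint : ∫ x : ℝ, g x ∂volume = 1)
    (ε k : ℝ) (hε : 0 ≤ ε) (hk : 0 ≤ k)
    (h : ∀ᵐ x ∂(volume : Measure ℝ),
      f x ≤ Real.exp (k * ε) * g x ∧ g x ≤ Real.exp (k * ε) * f x) :
    ((volume.withDensity fun x => ENNReal.ofReal (f x)).prod
        (volume.withDensity fun x => ENNReal.ofReal (g x))) {p : ℝ × ℝ | p.1 < p.2} ≤
      ENNReal.ofReal (Real.exp (k * ε)) *
        ((volume.withDensity fun x => ENNReal.ofReal (f x)).prod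
          (volume.withDensity fun x => ENNReal.ofReal (g x))) {p : ℝ × ℝ | p.2 < p.1} := by
  have hfi : Integrable f := by
    by_contra hn
    rw [integral_undef hn] at hfint; norm_num at hfint
  have hgi : Integrable g := by
    by_contra hn
    rw [integral_undef hn] at hgint; norm_num at hgint
  rw [aux_measure f g hf hg hf0 hg0 hfi hgi _ aux_meas_lt,
    aux_measure f g hf hg hf0 hg0 hfi hgi _ aux_meas_gt,
    ← ENNReal.ofReal_mul (Real.exp_pos _).le]
  apply ENNReal.ofReal_le_ofReal
  have hc1 : 1 ≤ Real.exp (k * ε) := Real.one_le_exp (mul_nonneg hk hε)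
  generalize Real.exp (k * ε) = c at h hc1 ⊢
  have h1 := aux_sum f g hfi hgi
  have h2 := aux_sum f f hfi hfi
  have h3 := aux_sum g g hgi hgi
  have h4 := aux_swap f g
  rw [aux_swap f f, hfint] at h2
  rw [aux_swap g g, hgint] at h3
  rw [hfint, hgint] at h1
  have hx := (Measure.quasiMeasurePreserving_fst (μ := (volume : Measure ℝ))
    (ν := (volume : Measure ℝ))).ae h
  have hy := (Measure.quasiMeasurePreserving_snd (μ := (volume : Measure ℝ))
    (ν := (volume : Measure ℝ))).ae h
  have hff := (hfi.mul_prod hfi).integrableOn (s := {p : ℝ × ℝ | p.2 < p.1})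
  have hfg := (hfi.mul_prod hgi).integrableOn (s := {p : ℝ × ℝ | p.2 < p.1})
  have hgf := (hgi.mul_prod hfi).integrableOn (s := {p : ℝ × ℝ | p.2 < p.1})
  have hgg := (hgi.mul_prod hgi).integrableOn (s := {p : ℝ × ℝ | p.2 < p.1})
  rcases hc1.eq_or_lt with rfl | hc
  · rw [h4, one_mul]
    apply le_of_eq
    apply integral_congr_ae
    apply ae_restrict_of_ae
    filter_upwards [hx, hy] with z hx hy
    have e1 : f z.1 = g z.1 := by linarith [hx.1, hx.2]
    have e2 : f z.2 = g z.2 := by linarith [hy.1, hy.2]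
    simp only [e1, e2]
  · have key : (∫ z in {p : ℝ × ℝ | p.2 < p.1}, (c * (f z.1 * f z.2) + c * (g z.1 * g z.2))
          ∂((volume : Measure ℝ).prod volume)) ≤
        ∫ z in {p : ℝ × ℝ | p.2 < p.1}, (c ^ 2 * (f z.1 * g z.2) + g z.1 * f z.2)
          ∂((volume : Measure ℝ).prod volume) := by
      apply integral_mono_ae ((hff.const_mul c).add (hgg.const_mul c))
        ((hfg.const_mul (c ^ 2)).add hgf)
      apply ae_restrict_of_ae
      filter_upwards [hx, hy] with z hx hy
      have := mul_nonneg (sub_nonneg.2 hx.2) (sub_nonneg.2 hy.1)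
      simp only [Pi.add_apply]
      linarith
    rw [integral_add (hff.const_mul c) (hgg.const_mul c),
      integral_add (hfg.const_mul (c ^ 2)) hgf] at key
    simp only [integral_const_mul] at key
    rw [← h4] at key
    generalize (∫ z in {p : ℝ × ℝ | p.1 < p.2}, f z.1 * g z.2
      ∂((volume : Measure ℝ).prod volume)) = a at *
    generalize (∫ z in {p : ℝ × ℝ | p.2 < p.1}, f z.1 * g z.2
      ∂((volume : Measure ℝ).prod volume)) = b at *
    generalize (∫ z in {p : ℝ × ℝ | p.2 < p.1}, f z.1 * f z.2
      ∂((volume : Measure ℝ).prod volume)) = d at *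
    generalize (∫ z in {p : ℝ × ℝ | p.2 < p.1}, g z.1 * g z.2
      ∂((volume : Measure ℝ).prod volume)) = e at *
    have hd : d = 1 / 2 := by linarith
    have he : e = 1 / 2 := by linarith
    have hb : b = 1 - a := by linarith
    subst hd he hb
    have : 0 ≤ (c - 1) * (c * (1 - a) - a) := by nlinarith
    have := nonneg_of_mul_nonneg_right this (by linarith)
    linarith
end

section
/- Let ε > 0 and λ > 0 be real numbers and let c, c' ∈ ℝ with |c − c'| ≤ λ. Then for every x ∈ ℝ, exp(−(ε/λ)·|x − c|) ≤ e^ε · exp(−(ε/λ)·|x − c'|). -/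
theorem laplace_density_ratio_bound (ε lam : ℝ) (hε : 0 < ε) (hlam : 0 < lam)
    (c c' : ℝ) (h : |c - c'| ≤ lam) (x : ℝ) :
    Real.exp (-(ε / lam) * |x - c|) ≤ Real.exp ε * Real.exp (-(ε / lam) * |x - c'|) := by
  rw [← Real.exp_add, Real.exp_le_exp]
  have h1 : |x - c'| ≤ |x - c| + |c - c'| := abs_sub_le x c c'
  have h2 : 0 < ε / lam := div_pos hε hlam
  have h3 : ε / lam * lam = ε := div_mul_cancel₀ ε hlam.ne'
  have h4 : ε / lam * |x - c'| ≤ ε / lam * (|x - c| + lam) :=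
    mul_le_mul_of_nonneg_left (by linarith) h2.le
  rw [mul_add, h3] at h4
  linarith
end

section
/- Let ε > 0 and λ > 0 be real numbers, and for c ∈ ℝ let μ_c denote the measure on ℝ with density x ↦ (ε/(2λ))·exp(−(ε/λ)·|x − c|) with respect to Lebesgue measure. Let c, c' ∈ ℝ with |c − c'| ≤ λ. Then (μ_c.prod μ_{c'}){(x,y) : x < y} ≤ e^ε · (μ_c.prod μ_{c'}){(x,y) : y < x}. -/
open MeasureTheory
open scoped ENNReal

/-- The Laplace distribution centered at `c` with scale `lam / ε`, i.e. the output
distribution of the Laplace mechanism with privacy parameter `ε` and sensitivity `lam`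
on an input with value `c`. -/
noncomputable def laplaceMeasure (ε lam c : ℝ) : Measure ℝ :=
  volume.withDensity fun x => ENNReal.ofReal (ε / (2 * lam) * Real.exp (-(ε / lam) * |x - c|))

lemma aux_exp_ineq (t : ℝ) (ht : 0 ≤ t) : 0 ≤ (t + 2) * Real.exp (-t) + t - 2 := by
  have hd : ∀ x : ℝ, HasDerivAt (fun t : ℝ => (t + 2) * Real.exp (-t) + t - 2)
      (1 * Real.exp (-x) + (x + 2) * (Real.exp (-x) * (-1)) + 1) x := by
    intro x
    exact ((((hasDerivAt_id x).add_const 2).mul ((hasDerivAt_id x).neg.exp)).add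
      (hasDerivAt_id x)).sub_const 2
  have hm : Monotone (fun t : ℝ => (t + 2) * Real.exp (-t) + t - 2) := by
    apply monotone_of_deriv_nonneg (fun x => (hd x).differentiableAt)
    intro x
    rw [(hd x).deriv]
    have h1 : (x + 1) * Real.exp (-x) ≤ Real.exp x * Real.exp (-x) :=
      mul_le_mul_of_nonneg_right (Real.add_one_le_exp x) (Real.exp_pos _).le
    rw [← Real.exp_add, add_neg_cancel, Real.exp_zero] at h1
    linarith
  have := hm ht
  simpa using this

lemma aux_lint_Iic (K k m a : ℝ) (hK : 0 ≤ K) (hk : 0 < k) :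
    ∫⁻ x in Set.Iic a, ENNReal.ofReal (K * Real.exp (k * x + m)) =
      ENNReal.ofReal (K / k * Real.exp (k * a + m)) := by
  have e : ∀ x, K * Real.exp (k * x + m) = (K * Real.exp m) * Real.exp (k * x) := by
    intro x; rw [Real.exp_add]; ring
  simp_rw [e]
  rw [← ofReal_integral_eq_lintegral_ofReal ((integrableOn_exp_mul_Iic hk a).const_mul _)
    (Filter.Eventually.of_forall fun x => by simp only [Pi.zero_apply]; positivity),
    integral_const_mul, integral_exp_mul_Iic hk, Real.exp_add]
  congr 1
  ring

lemma aux_lint_Ioi (K k m a : ℝ) (hK : 0 ≤ K) (hk : 0 < k) :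
    ∫⁻ x in Set.Ioi a, ENNReal.ofReal (K * Real.exp (-k * x + m)) =
      ENNReal.ofReal (K / k * Real.exp (-k * a + m)) := by
  have e : ∀ x, K * Real.exp (-k * x + m) = (K * Real.exp m) * Real.exp (-k * x) := by
    intro x; rw [Real.exp_add]; ring
  have hk' : -k < 0 := by linarith
  simp_rw [e]
  rw [← ofReal_integral_eq_lintegral_ofReal ((integrableOn_exp_mul_Ioi hk' a).const_mul _)
    (Filter.Eventually.of_forall fun x => by simp only [Pi.zero_apply]; positivity),
    integral_const_mul, integral_exp_mul_Ioi hk', Real.exp_add]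
  congr 1
  field_simp

lemma aux_meas (ε lam c : ℝ) : Measurable fun x : ℝ =>
    ENNReal.ofReal (ε / (2 * lam) * Real.exp (-(ε / lam) * |x - c|)) := by
  fun_prop

lemma aux_Iic (ε lam c a : ℝ) (hε : 0 < ε) (hlam : 0 < lam) (h : a ≤ c) :
    laplaceMeasure ε lam c (Set.Iic a) =
      ENNReal.ofReal (1 / 2 * Real.exp (ε / lam * (a - c))) := by
  rw [laplaceMeasure, withDensity_apply _ measurableSet_Iic,
    setLIntegral_congr_fun (g := fun x => ENNReal.ofReal (ε / (2 * lam) *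
      Real.exp (ε / lam * x + (-(ε / lam * c))))) measurableSet_Iic,
    aux_lint_Iic _ _ _ _ (by positivity) (by positivity)]
  · congr 2
    · field_simp
    · ring_nf
  · intro x hx
    simp only [Set.mem_Iic] at hx
    simp only
    rw [abs_of_nonpos (by linarith)]
    ring_nf

lemma aux_Ioi (ε lam c a : ℝ) (hε : 0 < ε) (hlam : 0 < lam) (h : c ≤ a) :
    laplaceMeasure ε lam c (Set.Ioi a) =
      ENNReal.ofReal (1 / 2 * Real.exp (-(ε / lam) * (a - c))) := by
  rw [laplaceMeasure, withDensity_apply _ measurableSet_Ioi,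
    setLIntegral_congr_fun (g := fun x => ENNReal.ofReal (ε / (2 * lam) *
      Real.exp (-(ε / lam) * x + ((ε / lam * c))))) measurableSet_Ioi,
    aux_lint_Ioi _ _ _ _ (by positivity) (by positivity)]
  · congr 2
    · field_simp
    · ring_nf
  · intro x hx
    simp only [Set.mem_Ioi] at hx
    simp only
    rw [abs_of_nonneg (by linarith)]
    ring_nf

lemma aux_prob (ε lam c : ℝ) (hε : 0 < ε) (hlam : 0 < lam) :
    IsProbabilityMeasure (laplaceMeasure ε lam c) := by
  constructor
  rw [← Set.Iic_union_Ioi (a := c), measure_union (Set.Iic_disjoint_Ioi le_rfl) measurableSet_Ioi,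
    aux_Iic _ _ _ _ hε hlam le_rfl, aux_Ioi _ _ _ _ hε hlam le_rfl,
    ← ENNReal.ofReal_add (by positivity) (by positivity)]
  simp
  norm_num

lemma aux_Iio (ε lam c a : ℝ) : laplaceMeasure ε lam c (Set.Iio a) =
    laplaceMeasure ε lam c (Set.Iic a) := by
  rw [laplaceMeasure]
  exact measure_congr ((withDensity_absolutelyContinuous _ _).ae_eq Iio_ae_eq_Iic)

lemma aux_Iio_right (ε lam c a : ℝ) (hε : 0 < ε) (hlam : 0 < lam) (h : c ≤ a) :
    laplaceMeasure ε lam c (Set.Iio a) =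
      ENNReal.ofReal (1 - 1 / 2 * Real.exp (-(ε / lam) * (a - c))) := by
  have := aux_prob ε lam c hε hlam
  rw [aux_Iio, ← Set.compl_Ioi, prob_compl_eq_one_sub measurableSet_Ioi,
    aux_Ioi _ _ _ _ hε hlam h, ENNReal.ofReal_sub _ (by positivity), ENNReal.ofReal_one]

lemma aux_tail (ε lam : ℝ) (hε : 0 < ε) (hlam : 0 < lam) (c c' : ℝ) (h : c ≤ c') :
    ((laplaceMeasure ε lam c).prod (laplaceMeasure ε lam c')) {p : ℝ × ℝ | p.2 < p.1} =
      ENNReal.ofReal (Real.exp (-(ε / lam * (c' - c))) * (1 / 2 + ε / lam * (c' - c) / 4)) := by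
  have := aux_prob ε lam c hε hlam
  have := aux_prob ε lam c' hε hlam
  have hb : 0 < ε / lam := by positivity
  have hK : ε / (2 * lam) = ε / lam / 2 := by field_simp
  rw [Measure.prod_apply (measurableSet_lt measurable_snd measurable_fst)]
  have e : ∀ x : ℝ, Prod.mk x ⁻¹' {p : ℝ × ℝ | p.2 < p.1} = Set.Iio x := by
    intro x; ext y; simp
  simp_rw [e]
  have hmono : Measurable fun x => laplaceMeasure ε lam c' (Set.Iio x) := by
    apply Monotone.measurable
    intro x y hxy
    exact measure_mono (Set.Iio_subset_Iio hxy)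
  conv_lhs => rw [laplaceMeasure]
  rw [lintegral_withDensity_eq_lintegral_mul _ (aux_meas _ _ _) hmono]
  simp only [Pi.mul_apply, hK]
  set b := ε / lam with hbdef
  rw [← setLIntegral_univ, ← Set.Iic_union_Ioi (a := c'),
    lintegral_union measurableSet_Ioi (Set.Iic_disjoint_Ioi le_rfl),
    ← Set.Iic_union_Ioc_eq_Iic h,
    lintegral_union measurableSet_Ioc (Set.Iic_disjoint_Ioc le_rfl)]
  have h1 : ∫⁻ x in Set.Iic c, ENNReal.ofReal (b / 2 * Real.exp (-b * |x - c|)) *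
      laplaceMeasure ε lam c' (Set.Iio x) = ENNReal.ofReal (Real.exp (-(b * (c' - c))) / 8) := by
    rw [setLIntegral_congr_fun (g := fun x => ENNReal.ofReal (b / 4 *
      Real.exp (2 * b * x + (-b * c - b * c')))) measurableSet_Iic,
      aux_lint_Iic _ _ _ _ (by positivity) (by positivity)]
    · congr 1
      rw [show 2 * b * c + (-b * c - b * c') = -(b * (c' - c)) by ring]
      field_simp
      norm_num
    · intro x hx
      simp only [Set.mem_Iic] at hx
      simp only
      rw [aux_Iio, aux_Iic _ _ _ _ hε hlam (hx.trans h), ← ENNReal.ofReal_mul (by positivity),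
        abs_of_nonpos (by linarith), ← hbdef,
        show 2 * b * x + (-b * c - b * c') = (-b * -(x - c)) + b * (x - c') by ring, Real.exp_add]
      ring_nf
  have h2 : ∫⁻ x in Set.Ioc c c', ENNReal.ofReal (b / 2 * Real.exp (-b * |x - c|)) *
      laplaceMeasure ε lam c' (Set.Iio x) =
        ENNReal.ofReal (Real.exp (-(b * (c' - c))) * (b * (c' - c) / 4)) := by
    rw [setLIntegral_congr_fun (g := fun x => ENNReal.ofReal (b / 4 *
      Real.exp (-(b * (c' - c))))) measurableSet_Ioc, setLIntegral_const, Real.volume_Ioc,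
      ← ENNReal.ofReal_mul (by positivity)]
    · congr 1
      ring
    · intro x hx
      simp only [Set.mem_Ioc] at hx
      simp only
      rw [aux_Iio, aux_Iic _ _ _ _ hε hlam hx.2, ← ENNReal.ofReal_mul (by positivity),
        abs_of_nonneg (by linarith), ← hbdef,
        show -(b * (c' - c)) = (-b * (x - c)) + b * (x - c') by ring, Real.exp_add]
      ring_nf
  have h3 : ∫⁻ x in Set.Ioi c', ENNReal.ofReal (b / 2 * Real.exp (-b * |x - c|)) *
      laplaceMeasure ε lam c' (Set.Iio x) =
        ENNReal.ofReal (Real.exp (-(b * (c' - c))) * (3 / 8)) := by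
    have g1 := aux_lint_Ioi (b / 2) b (b * c) c' (by positivity) hb
    have g2 := aux_lint_Ioi (b / 4) (2 * b) (b * c + b * c') c' (by positivity) (by positivity)
    rw [setLIntegral_congr_fun (g := fun x => (ENNReal.ofReal (b / 2 * Real.exp (-b * |x - c|)) *
      laplaceMeasure ε lam c' (Set.Iio x)) + ENNReal.ofReal (b / 4 *
      Real.exp (-(2 * b) * x + (b * c + b * c')))) measurableSet_Ioi,
      lintegral_add_right _ (by fun_prop), g2] at g1
    · rw [ENNReal.eq_sub_of_add_eq ENNReal.ofReal_ne_top g1,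
        ← ENNReal.ofReal_sub _ (by positivity)]
      congr 1
      rw [show -(2 * b) * c' + (b * c + b * c') = -(b * (c' - c)) by ring,
        show -b * c' + b * c = -(b * (c' - c)) by ring]
      field_simp
      norm_num
    · intro x hx
      simp only [Set.mem_Ioi] at hx
      simp only
      have hle : Real.exp (-b * (x - c')) ≤ 1 := by
        rw [Real.exp_le_one_iff]
        nlinarith
      rw [aux_Iio_right _ _ _ _ hε hlam hx.le, ← ENNReal.ofReal_mul (by positivity),
        abs_of_nonneg (by linarith), ← hbdef,
        ← ENNReal.ofReal_add (mul_nonneg (by positivity) (by linarith)) (by positivity),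
        show -(2 * b) * x + (b * c + b * c') = (-b * (x - c)) + (-b * (x - c')) by ring,
        Real.exp_add (-b * (x - c)),
        show -b * x + b * c = -b * (x - c) by ring]
      ring_nf
  have hd : 0 ≤ c' - c := by linarith
  rw [h1, h2, h3, ← ENNReal.ofReal_add (by positivity) (by positivity),
    ← ENNReal.ofReal_add (by positivity) (by positivity)]
  congr 1
  ring

theorem laplace_ordering_equality (ε lam : ℝ) (hε : 0 < ε) (hlam : 0 < lam)
    (c c' : ℝ) (h : |c - c'| ≤ lam) :
    ((laplaceMeasure ε lam c).prod (laplaceMeasure ε lam c')) {p : ℝ × ℝ | p.1 < p.2} ≤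
      ENNReal.ofReal (Real.exp ε) *
        ((laplaceMeasure ε lam c).prod (laplaceMeasure ε lam c')) {p : ℝ × ℝ | p.2 < p.1} := by
  have := aux_prob ε lam c hε hlam
  have := aux_prob ε lam c' hε hlam
  have hS : MeasurableSet {p : ℝ × ℝ | p.2 < p.1} := measurableSet_lt measurable_snd measurable_fst
  have hS' : MeasurableSet {p : ℝ × ℝ | p.1 < p.2} := measurableSet_lt measurable_fst measurable_snd
  rcases le_total c c' with hc | hc
  · have hsub : {p : ℝ × ℝ | p.1 < p.2} ⊆ {p : ℝ × ℝ | p.2 < p.1}ᶜ := by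
      intro p hp
      simp only [Set.mem_setOf_eq, Set.mem_compl_iff, not_lt] at *
      exact hp.le
    refine (measure_mono hsub).trans ?_
    have hd : 0 ≤ c' - c := by linarith
    rw [prob_compl_eq_one_sub hS, aux_tail _ _ hε hlam _ _ hc, ← ENNReal.ofReal_one,
      ← ENNReal.ofReal_sub _ (by positivity), ← ENNReal.ofReal_mul (by positivity)]
    apply ENNReal.ofReal_le_ofReal
    set t := ε / lam * (c' - c) with ht
    have ht0 : 0 ≤ t := by positivity
    have hte : t ≤ ε := by
      rw [abs_le] at h
      calc t ≤ ε / lam * lam := by rw [ht]; gcongr; linarith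
        _ = ε := by field_simp
    have k1 := aux_exp_ineq t ht0
    have k2 : Real.exp t ≤ Real.exp ε := Real.exp_le_exp.mpr hte
    have k3 : Real.exp t * Real.exp (-t) = 1 := by rw [← Real.exp_add]; simp
    have k4 : Real.exp t * (Real.exp (-t) * (1 / 2 + t / 4)) ≤
        Real.exp ε * (Real.exp (-t) * (1 / 2 + t / 4)) := by gcongr
    rw [← mul_assoc, k3] at k4
    linarith
  · have hL := aux_meas ε lam c
    have hR := aux_meas ε lam c'
    have hle : ((laplaceMeasure ε lam c).prod (laplaceMeasure ε lam c')) {p : ℝ × ℝ | p.1 < p.2} ≤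
        ((laplaceMeasure ε lam c).prod (laplaceMeasure ε lam c')) {p : ℝ × ℝ | p.2 < p.1} := by
      have sw : ((laplaceMeasure ε lam c).prod (laplaceMeasure ε lam c')) {p : ℝ × ℝ | p.2 < p.1} =
          ((laplaceMeasure ε lam c').prod (laplaceMeasure ε lam c)) {p : ℝ × ℝ | p.1 < p.2} := by
        rw [← Measure.prod_swap, Measure.map_apply measurable_swap hS]
        rfl
      rw [sw]
      simp only [laplaceMeasure]
      rw [prod_withDensity hL hR, prod_withDensity hR hL, withDensity_apply _ hS',
        withDensity_apply _ hS']
      refine setLIntegral_mono (by fun_prop) ?_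
      rintro ⟨x, y⟩ hxy
      simp only [Set.mem_setOf_eq] at hxy
      simp only
      rw [← ENNReal.ofReal_mul (by positivity), ← ENNReal.ofReal_mul (by positivity)]
      apply ENNReal.ofReal_le_ofReal
      have key : |x - c'| + |y - c| ≤ |x - c| + |y - c'| := by
        rcases abs_cases (x - c) with h1 | h1 <;> rcases abs_cases (y - c') with h2 | h2 <;>
        rcases abs_cases (x - c') with h3 | h3 <;> rcases abs_cases (y - c) with h4 | h4 <;>
        linarith
      have hb : 0 < ε / lam := by positivity
      have key2 : Real.exp (-(ε / lam) * |x - c|) * Real.exp (-(ε / lam) * |y - c'|) ≤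
          Real.exp (-(ε / lam) * |x - c'|) * Real.exp (-(ε / lam) * |y - c|) := by
        rw [← Real.exp_add, ← Real.exp_add, Real.exp_le_exp]
        nlinarith
      have hK : 0 ≤ ε / (2 * lam) * (ε / (2 * lam)) := by positivity
      have := mul_le_mul_of_nonneg_left key2 hK
      linarith
    refine hle.trans (le_mul_of_one_le_left (by positivity) ?_)
    rw [ENNReal.one_le_ofReal]
    exact Real.one_le_exp hε.le
end

section
/- Let ε > 0, λ > 0, and k ≥ 0 be real numbers, and for c ∈ ℝ let μ_c denote the measure on ℝ with density x ↦ (ε/(2λ))·exp(−(ε/λ)·|x − c|) with respect to Lebesgue measure. Let c, c' ∈ ℝ with |c − c'| ≤ k·λ. Then (μ_c.prod μ_{c'}){(x,y) : x < y} ≤ e^{kε} · (μ_c.prod μ_{c'}){(x,y) : y < x}. -/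
open MeasureTheory
open scoped ENNReal

open Set

lemma lap_lint_Ioi (A r a b : ℝ) (hA : 0 ≤ A) (hr : 0 < r) :
    ∫⁻ x in Ioi a, ENNReal.ofReal (A * Real.exp (-r * (x - b)))
      = ENNReal.ofReal (A / r * Real.exp (-r * (a - b))) := by
  have e : ∀ x, A * Real.exp (-r * (x - b)) = (A * Real.exp (r * b)) * Real.exp (-r * x) := by
    intro x; rw [mul_assoc, ← Real.exp_add]; congr 2; ring
  simp only [e]
  rw [← ofReal_integral_eq_lintegral_ofReal]
  · rw [integral_const_mul, integral_exp_mul_Ioi (by linarith)]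
    congr 1
    have : Real.exp (-r * (a - b)) = Real.exp (r * b) * Real.exp (-r * a) := by
      rw [← Real.exp_add]; congr 1; ring
    rw [this]; field_simp
  · exact (integrableOn_exp_mul_Ioi (by linarith) a).const_mul _
  · exact Filter.Eventually.of_forall fun x => by positivity

lemma lap_integrable_Iic (A r a b : ℝ) (hr : 0 < r) :
    IntegrableOn (fun x => A * Real.exp (r * (x - b))) (Iic a) := by
  have e : ∀ x, A * Real.exp (r * (x - b)) = (A * Real.exp (-r * b)) * Real.exp (r * x) := by
    intro x; rw [mul_assoc, ← Real.exp_add]; congr 2; ring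
  simp only [e]
  exact (integrableOn_exp_mul_Iic hr a).const_mul _

lemma lap_int_Iic (A r a b : ℝ) (hr : 0 < r) :
    ∫ x in Iic a, (A * Real.exp (r * (x - b))) = A / r * Real.exp (r * (a - b)) := by
  have e : ∀ x, A * Real.exp (r * (x - b)) = (A * Real.exp (-r * b)) * Real.exp (r * x) := by
    intro x; rw [mul_assoc, ← Real.exp_add]; congr 2; ring
  simp only [e]
  rw [integral_const_mul, integral_exp_mul_Iic hr]
  have : Real.exp (r * (a - b)) = Real.exp (-r * b) * Real.exp (r * a) := by
    rw [← Real.exp_add]; congr 1; ring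
  rw [this]; field_simp

lemma lap_lint_Iic (A r a b : ℝ) (hA : 0 ≤ A) (hr : 0 < r) :
    ∫⁻ x in Iic a, ENNReal.ofReal (A * Real.exp (r * (x - b)))
      = ENNReal.ofReal (A / r * Real.exp (r * (a - b))) := by
  rw [← lap_int_Iic A r a b hr, ← ofReal_integral_eq_lintegral_ofReal]
  · exact lap_integrable_Iic A r a b hr
  · exact Filter.Eventually.of_forall fun x => by positivity

lemma lap_dens (ε lam c : ℝ) : laplaceMeasure ε lam c = volume.withDensity
    (fun x => ENNReal.ofReal ((ε / lam) / 2 * Real.exp (-(ε / lam) * |x - c|))) := by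
  unfold laplaceMeasure
  congr 1; ext x; congr 2; rw [div_div, mul_comm]

lemma lap_meas (r c : ℝ) :
    Measurable (fun x : ℝ => ENNReal.ofReal (r / 2 * Real.exp (-r * |x - c|))) := by
  fun_prop

noncomputable def lapM (r c : ℝ) : Measure ℝ := volume.withDensity
    (fun x => ENNReal.ofReal (r / 2 * Real.exp (-r * |x - c|)))

lemma lapM_Ioi (r c y : ℝ) (hr : 0 < r) (hy : c ≤ y) :
    lapM r c (Ioi y) = ENNReal.ofReal (1 / 2 * Real.exp (-r * (y - c))) := by
  rw [lapM, withDensity_apply _ measurableSet_Ioi]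
  have : ∫⁻ x in Ioi y, ENNReal.ofReal (r / 2 * Real.exp (-r * |x - c|))
      = ∫⁻ x in Ioi y, ENNReal.ofReal (r / 2 * Real.exp (-r * (x - c))) := by
    refine setLIntegral_congr_fun measurableSet_Ioi fun x hx => ?_
    have hx' : y < x := hx
    simp only [abs_of_nonneg (show 0 ≤ x - c by linarith)]
  rw [this, lap_lint_Ioi _ _ _ _ (by positivity) hr]
  congr 2; field_simp

lemma lapM_Iic (r c y : ℝ) (hr : 0 < r) (hy : y ≤ c) :
    lapM r c (Iic y) = ENNReal.ofReal (1 / 2 * Real.exp (r * (y - c))) := by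
  rw [lapM, withDensity_apply _ measurableSet_Iic]
  have : ∫⁻ x in Iic y, ENNReal.ofReal (r / 2 * Real.exp (-r * |x - c|))
      = ∫⁻ x in Iic y, ENNReal.ofReal (r / 2 * Real.exp (r * (x - c))) := by
    refine setLIntegral_congr_fun measurableSet_Iic fun x hx => ?_
    have hx' : x ≤ y := hx
    simp only [abs_of_nonpos (show x - c ≤ 0 by linarith)]
    congr 3; ring
  rw [this, lap_lint_Iic _ _ _ _ (by positivity) hr]
  congr 2; field_simp

lemma lapM_prob (r c : ℝ) (hr : 0 < r) : IsProbabilityMeasure (lapM r c) := by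
  constructor
  rw [← Iic_union_Ioi (a := c), measure_union (by simp) measurableSet_Ioi,
    lapM_Ioi r c c hr le_rfl, lapM_Iic r c c hr le_rfl, ← ENNReal.ofReal_add (by positivity)
    (by positivity)]
  norm_num

lemma lapM_Ioi' (r c y : ℝ) (hr : 0 < r) (hy : y ≤ c) :
    lapM r c (Ioi y) = ENNReal.ofReal (1 - 1 / 2 * Real.exp (r * (y - c))) := by
  have := lapM_prob r c hr
  rw [← compl_Iic, prob_compl_eq_one_sub measurableSet_Iic, lapM_Iic r c y hr hy,
    ENNReal.ofReal_sub _ (by positivity), ENNReal.ofReal_one]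

lemma lapM_T (r c c' : ℝ) (hr : 0 < r) (h : c ≤ c') :
    ENNReal.ofReal (Real.exp (-(r * (c' - c))) * (1 / 2 + r * (c' - c) / 4)) ≤
      ((lapM r c).prod (lapM r c')) {p : ℝ × ℝ | p.2 < p.1} := by
  have := lapM_prob r c hr
  have := lapM_prob r c' hr
  have hm : MeasurableSet {p : ℝ × ℝ | p.2 < p.1} := measurableSet_lt measurable_snd measurable_fst
  have hpre : ∀ y : ℝ, (fun x : ℝ => (x, y)) ⁻¹' {p : ℝ × ℝ | p.2 < p.1} = Ioi y := by
    intro y; ext x; simp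
  rw [Measure.prod_apply_symm hm]
  simp only [hpre]
  have hmono : Measurable (fun y : ℝ => lapM r c (Ioi y)) := by
    refine Antitone.measurable fun a b hab => measure_mono (Ioi_subset_Ioi hab)
  rw [show (lapM r c') = _ from rfl, lapM.eq_1 r c',
    lintegral_withDensity_eq_lintegral_mul _ (lap_meas r c') hmono]
  simp only [Pi.mul_apply]
  set F : ℝ → ℝ≥0∞ := fun y =>
    ENNReal.ofReal (r / 2 * Real.exp (-r * |y - c'|)) * lapM r c (Ioi y) with hF
  set E := Real.exp (-(r * (c' - c))) with hE
  have hEpos : 0 < E := Real.exp_pos _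
  have h1 : ∫⁻ y in Iic c, F y = ENNReal.ofReal (3 / 8 * E) := by
    have : ∫⁻ y in Iic c, F y = ∫⁻ y in Iic c, ENNReal.ofReal
        (r / 2 * Real.exp (r * (y - c')) - r / 4 * E * Real.exp ((2 * r) * (y - c))) := by
      refine setLIntegral_congr_fun measurableSet_Iic fun y hy => ?_
      have hy' : y ≤ c := hy
      simp only [hF]
      rw [lapM_Ioi' r c y hr hy', abs_of_nonpos (by linarith), ← ENNReal.ofReal_mul (by positivity)]
      congr 1
      have e2 : E * Real.exp ((2 * r) * (y - c))
          = Real.exp (r * (y - c')) * Real.exp (r * (y - c)) := by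
        rw [hE, ← Real.exp_add, ← Real.exp_add]; congr 1; ring
      rw [mul_assoc (r / 4), e2, show -r * -(y - c') = r * (y - c') by ring]; ring
    rw [this, ← ofReal_integral_eq_lintegral_ofReal]
    · rw [integral_sub (lap_integrable_Iic _ _ _ _ hr) (lap_integrable_Iic _ _ _ _ (by linarith)),
        lap_int_Iic _ _ _ _ hr, lap_int_Iic _ _ _ _ (by linarith)]
      congr 1
      rw [show r * (c - c') = -(r * (c' - c)) by ring, ← hE]
      simp only [sub_self, mul_zero, Real.exp_zero]
      field_simp; norm_num
    · exact (lap_integrable_Iic _ _ _ _ hr).sub (lap_integrable_Iic _ _ _ _ (by linarith))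
    · refine (ae_restrict_iff' measurableSet_Iic).2 (Filter.Eventually.of_forall fun y hy => ?_)
      have hy' : y ≤ c := hy
      have e2 : E * Real.exp ((2 * r) * (y - c))
          = Real.exp (r * (y - c')) * Real.exp (r * (y - c)) := by
        rw [hE, ← Real.exp_add, ← Real.exp_add]; congr 1; ring
      have : Real.exp (r * (y - c)) ≤ 1 := Real.exp_le_one_iff.2 (by nlinarith)
      have h3 := Real.exp_pos (r * (y - c'))
      simp only [Pi.zero_apply]
      rw [mul_assoc (r / 4), e2]
      have : 0 ≤ r * Real.exp (r * (y - c')) * (2 - Real.exp (r * (y - c))) := by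
        apply mul_nonneg (by positivity); linarith
      nlinarith
  have h2 : ∫⁻ y in Ioc c c', F y = ENNReal.ofReal (r * (c' - c) / 4 * E) := by
    have : ∫⁻ y in Ioc c c', F y = ∫⁻ y in Ioc c c', ENNReal.ofReal (r / 4 * E) := by
      refine setLIntegral_congr_fun measurableSet_Ioc fun y hy => ?_
      simp only [hF]
      rw [lapM_Ioi r c y hr hy.1.le, abs_of_nonpos (by linarith [hy.2]),
        ← ENNReal.ofReal_mul (by positivity)]
      congr 1
      have : E = Real.exp (-r * -(y - c')) * Real.exp (-r * (y - c)) := by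
        rw [hE, ← Real.exp_add]; congr 1; ring
      rw [this]; ring
    rw [this, setLIntegral_const, Real.volume_Ioc, ← ENNReal.ofReal_mul (by positivity)]
    congr 1; ring
  have h3 : ∫⁻ y in Ioi c', F y = ENNReal.ofReal (1 / 8 * E) := by
    have : ∫⁻ y in Ioi c', F y = ∫⁻ y in Ioi c', ENNReal.ofReal
        (r / 4 * E * Real.exp (-(2 * r) * (y - c'))) := by
      refine setLIntegral_congr_fun measurableSet_Ioi fun y hy => ?_
      have hy' : c' < y := hy
      simp only [hF]
      rw [lapM_Ioi r c y hr (by linarith), abs_of_nonneg (by linarith),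
        ← ENNReal.ofReal_mul (by positivity)]
      congr 1
      have : E * Real.exp (-(2 * r) * (y - c'))
          = Real.exp (-r * (y - c')) * Real.exp (-r * (y - c)) := by
        rw [hE, ← Real.exp_add, ← Real.exp_add]; congr 1; ring
      rw [mul_assoc (r / 4), this]; ring
    rw [this, lap_lint_Ioi _ _ _ _ (by positivity) (by linarith)]
    congr 1
    simp only [sub_self, mul_zero, Real.exp_zero]
    field_simp; norm_num
  have hd : 0 ≤ r * (c' - c) := mul_nonneg hr.le (by linarith)
  rw [← lintegral_add_compl F (measurableSet_Iic (a := c)), compl_Iic,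
    ← Ioc_union_Ioi_eq_Ioi h, lintegral_union measurableSet_Ioi (Ioc_disjoint_Ioi le_rfl),
    h1, h2, h3, ← ENNReal.ofReal_add (by positivity) (by positivity),
    ← ENNReal.ofReal_add (by positivity) (by positivity)]
  apply le_of_eq; congr 1; ring

lemma exp_pade (d : ℝ) (hd : 0 ≤ d) : Real.exp d * (2 - d) ≤ 2 + d := by
  have : MonotoneOn (fun x : ℝ => 2 + x - Real.exp x * (2 - x)) (Ici 0) := by
    refine monotoneOn_of_hasDerivWithinAt_nonneg (f' := fun x => 1 - Real.exp x * (1 - x))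
      (convex_Ici 0) (by fun_prop) ?_ ?_
    · intro x _
      have := ((hasDerivAt_id x).const_add 2).sub
        ((Real.hasDerivAt_exp x).mul ((hasDerivAt_id x).const_sub 2))
      refine (this.congr_deriv ?_).hasDerivWithinAt
      simp; ring
    · intro x _
      have h1 := Real.add_one_le_exp (-x)
      have h2 : Real.exp x * Real.exp (-x) = 1 := by rw [← Real.exp_add]; simp
      have := Real.exp_pos x
      nlinarith
  have := this (by simp : (0:ℝ) ∈ Ici 0) hd hd
  simp at this
  linarith

lemma lapM_main (r δ c c' : ℝ) (hr : 0 < r) (hδ : r * |c - c'| ≤ δ) :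
    ((lapM r c).prod (lapM r c')) {p : ℝ × ℝ | p.1 < p.2} ≤
      ENNReal.ofReal (Real.exp δ) *
        ((lapM r c).prod (lapM r c')) {p : ℝ × ℝ | p.2 < p.1} := by
  have i1 := lapM_prob r c hr
  have i2 := lapM_prob r c' hr
  have hm : MeasurableSet {p : ℝ × ℝ | p.2 < p.1} := measurableSet_lt measurable_snd measurable_fst
  have hm' : MeasurableSet {p : ℝ × ℝ | p.1 < p.2} := measurableSet_lt measurable_fst measurable_snd
  have hδ0 : 0 ≤ δ := le_trans (by positivity) hδ
  rcases le_total c c' with h | h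
  · have hT := lapM_T r c c' hr h
    set P := (lapM r c).prod (lapM r c')
    have hle : P {p : ℝ × ℝ | p.1 < p.2} ≤ 1 - P {p : ℝ × ℝ | p.2 < p.1} := by
      rw [← prob_compl_eq_one_sub hm]
      exact measure_mono fun p hp => by
        simp only [mem_compl_iff, mem_setOf_eq, not_lt] at *; exact hp.le
    refine hle.trans ?_
    rw [tsub_le_iff_right]
    have hd : 0 ≤ r * (c' - c) := mul_nonneg hr.le (by linarith)
    rw [abs_sub_comm, abs_of_nonneg (by linarith : 0 ≤ c' - c)] at hδ
    set d := r * (c' - c)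
    calc (1 : ℝ≥0∞) = ENNReal.ofReal 1 := by simp
      _ ≤ ENNReal.ofReal (Real.exp d * (Real.exp (-d) * (1 / 2 + d / 4))
            + (Real.exp (-d) * (1 / 2 + d / 4))) := by
          apply ENNReal.ofReal_le_ofReal
          have h2 : Real.exp d * Real.exp (-d) = 1 := by rw [← Real.exp_add]; simp
          have := exp_pade d hd
          have h4 := mul_le_mul_of_nonneg_left this (Real.exp_pos (-d)).le
          have h5 : Real.exp (-d) * (Real.exp d * (2 - d)) = 2 - d := by
            rw [← mul_assoc, mul_comm (Real.exp (-d)), h2, one_mul]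
          rw [← mul_assoc, h2]
          linarith
      _ = ENNReal.ofReal (Real.exp d) * ENNReal.ofReal (Real.exp (-d) * (1 / 2 + d / 4))
            + ENNReal.ofReal (Real.exp (-d) * (1 / 2 + d / 4)) := by
          rw [ENNReal.ofReal_add (by positivity) (by positivity),
            ENNReal.ofReal_mul (by positivity)]
      _ ≤ _ := by gcongr
  · have key : ((lapM r c).prod (lapM r c')) {p : ℝ × ℝ | p.1 < p.2} ≤
        ((lapM r c).prod (lapM r c')) {p : ℝ × ℝ | p.2 < p.1} := by
      have hs : ((lapM r c).prod (lapM r c')) {p : ℝ × ℝ | p.2 < p.1}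
          = ((lapM r c').prod (lapM r c)) {p : ℝ × ℝ | p.1 < p.2} := by
        rw [← Measure.prod_swap, Measure.map_apply measurable_swap hm]; rfl
      rw [hs]
      unfold lapM
      rw [prod_withDensity (lap_meas r c) (lap_meas r c'),
        prod_withDensity (lap_meas r c') (lap_meas r c),
        withDensity_apply _ hm', withDensity_apply _ hm']
      refine setLIntegral_mono' hm' fun p hp => ?_
      have hp' : p.1 < p.2 := hp
      rw [← ENNReal.ofReal_mul (by positivity), ← ENNReal.ofReal_mul (by positivity)]
      apply ENNReal.ofReal_le_ofReal
      have : |p.1 - c'| + |p.2 - c| ≤ |p.1 - c| + |p.2 - c'| := by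
        rcases abs_cases (p.1 - c') with h1 | h1 <;> rcases abs_cases (p.2 - c) with h2 | h2 <;>
        rcases abs_cases (p.1 - c) with h3 | h3 <;> rcases abs_cases (p.2 - c') with h4 | h4 <;>
        linarith
      have e : Real.exp (-r * |p.1 - c|) * Real.exp (-r * |p.2 - c'|)
          ≤ Real.exp (-r * |p.1 - c'|) * Real.exp (-r * |p.2 - c|) := by
        rw [← Real.exp_add, ← Real.exp_add]
        apply Real.exp_le_exp.2
        nlinarith
      rw [mul_mul_mul_comm, mul_mul_mul_comm (r / 2) _ (r / 2)]
      gcongr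
    refine key.trans ?_
    refine le_mul_of_one_le_left (zero_le) ?_
    rw [ENNReal.one_le_ofReal]
    exact Real.one_le_exp hδ0

theorem laplace_group_ordering_equality (ε lam k : ℝ) (hε : 0 < ε) (hlam : 0 < lam)
    (hk : 0 ≤ k) (c c' : ℝ) (h : |c - c'| ≤ k * lam) :
    ((laplaceMeasure ε lam c).prod (laplaceMeasure ε lam c')) {p : ℝ × ℝ | p.1 < p.2} ≤
      ENNReal.ofReal (Real.exp (k * ε)) *
        ((laplaceMeasure ε lam c).prod (laplaceMeasure ε lam c')) {p : ℝ × ℝ | p.2 < p.1} := by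
  rw [lap_dens ε lam c, lap_dens ε lam c']
  refine lapM_main (ε / lam) (k * ε) c c' (by positivity) ?_
  calc ε / lam * |c - c'| ≤ ε / lam * (k * lam) := by gcongr
    _ = k * ε := by field_simp
end

section
/- Let ε ≥ 0 and let P, Q be nonnegative real numbers with P + Q = 1, P ≤ e^ε · Q, and Q ≤ e^ε · P. Then |P − Q| ≤ (e^ε − 1)/(e^ε + 1). -/
theorem multiplicative_implies_additive_ordering_equality (ε P Q : ℝ) (hε : 0 ≤ ε)
    (hP : 0 ≤ P) (hQ : 0 ≤ Q) (hPQ : P + Q = 1)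
    (h1 : P ≤ Real.exp ε * Q) (h2 : Q ≤ Real.exp ε * P) :
    |P - Q| ≤ (Real.exp ε - 1) / (Real.exp ε + 1) := by
  have hE := Real.exp_pos ε
  obtain rfl : Q = 1 - P := by linarith
  rw [le_div_iff₀ (by linarith)]
  rcases abs_cases (P - (1 - P)) with ⟨h, _⟩ | ⟨h, _⟩ <;> rw [h] <;> nlinarith
end
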